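/- Let q ≥ 4. For every open set Ω ⊊ ℝ and every f ∈ C_0^∞(Ω) one has sup_{t ∈ Ω} |f(t)|^q ≤ q² · ( ∫_Ω ( |f′(t)|² − |f(t)|²/(4 dist(t, Ω^c)²) ) dt ) · ( ∫_Ω |f(t)|² dt )^{2/(q−2)} · ( ∫_Ω |f(t)|^q dt )^{(q−4)/(q−2)}. -/

import Mathlib

open MeasureTheory Metric Set

/-- The Cauchy–Schwarz inequality for continuous functions on a compact interval. -/
theorem intervalIntegral_mul_le_sqrt_mul_sqrt {u v : ℝ → ℝ} {a b : ℝ} (hab : a ≤ b)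
    (hu : ContinuousOn u (Icc a b)) (hv : ContinuousOn v (Icc a b)) :
    ∫ s in a..b, u s * v s ≤ √(∫ s in a..b, u s ^ 2) * √(∫ s in a..b, v s ^ 2) := by
  have hI {g : ℝ → ℝ} (hg : ContinuousOn g (Icc a b)) : IntervalIntegrable g volume a b :=
    hg.intervalIntegrable_of_Icc hab
  have huu : IntervalIntegrable (fun s => u s ^ 2) volume a b := hI (hu.pow 2)
  have huv : IntervalIntegrable (fun s => u s * v s) volume a b := hI (hu.mul hv)
  have hvv : IntervalIntegrable (fun s => v s ^ 2) volume a b := hI (hv.pow 2)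
  have key : ∀ x : ℝ, 0 ≤ (∫ s in a..b, v s ^ 2) * (x * x) + (2 * ∫ s in a..b, u s * v s) * x
      + ∫ s in a..b, u s ^ 2 := by
    intro x
    have h0 : 0 ≤ ∫ s in a..b, (u s + x * v s) ^ 2 :=
      intervalIntegral.integral_nonneg hab fun s _ => sq_nonneg _
    have h1 : ∫ s in a..b, (u s + x * v s) ^ 2
        = ∫ s in a..b, (u s ^ 2 + (2 * x) * (u s * v s) + (x * x) * v s ^ 2) := by
      congr 1; ext s; ring
    rw [h1, intervalIntegral.integral_add (huu.add (huv.const_mul _)) (hvv.const_mul _),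
      intervalIntegral.integral_add huu (huv.const_mul _), intervalIntegral.integral_const_mul,
      intervalIntegral.integral_const_mul] at h0
    linarith
  have hd := discrim_le_zero key
  rw [discrim] at hd
  have hu0 : 0 ≤ ∫ s in a..b, u s ^ 2 :=
    intervalIntegral.integral_nonneg hab fun s _ => sq_nonneg _
  rw [← Real.sqrt_mul hu0]
  apply Real.le_sqrt_of_sq_le
  linarith

/-- Hardy–Sobolev estimates on `[a', c]` for a function vanishing at `a'`, with the Hardy weight
singular at a point `a < a'`. -/
theorem hardy_sobolev_half {q : ℝ} (hq : 4 ≤ q) {f : ℝ → ℂ} (hf : ContDiff ℝ 1 f) {a a' c : ℝ}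
    (haa : a < a') (hac : a' ≤ c) (h0 : f a' = 0) {E B : ℝ}
    (hE : E = ∫ s in a'..c, (‖deriv f s‖ ^ 2 - ‖f s‖ ^ 2 / (4 * (s - a) ^ 2)))
    (hB : B = ∫ s in a'..c, ‖f s‖ ^ (q - 2)) :
    0 ≤ E ∧ ‖f c‖ ^ (q / 2) ≤ q * (√E * √B) ∧
      ∀ x ∈ Icc a' c, ‖f x‖ ^ (q / 2) ≤ ‖f c‖ ^ (q / 2) + q / 2 * (√E * √B) := by
  have hpos : ∀ s ∈ Icc a' c, 0 < s - a := fun s hs => by linarith [hs.1]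
  have hne : ∀ s ∈ Icc a' c, s - a ≠ 0 := fun s hs => (hpos s hs).ne'
  have hfc : Continuous f := hf.continuous
  have hf' : ∀ s, HasDerivAt f (deriv f s) s := fun s =>
    (hf.differentiable (by norm_num) s).hasDerivAt
  have hf'c : Continuous (deriv f) := hf.continuous_deriv (by norm_num)
  have hI {g : ℝ → ℝ} (hg : ContinuousOn g (Icc a' c)) : IntervalIntegrable g volume a' c :=
    hg.intervalIntegrable_of_Icc hac
  have hw : ContinuousOn (fun s : ℝ => (s - a)⁻¹) (Icc a' c) :=
    ContinuousOn.inv₀ (by fun_prop) hne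
  obtain ⟨h, hh⟩ : ∃ h : ℝ → ℂ, ∀ s, h s = deriv f s - ((s - a)⁻¹ / 2) • f s := ⟨_, fun _ => rfl⟩
  have hhc : ContinuousOn h (Icc a' c) := by
    rw [show h = fun s => deriv f s - ((s - a)⁻¹ / 2) • f s from funext hh]
    exact hf'c.continuousOn.sub ((hw.div_const _).smul hfc.continuousOn)
  obtain ⟨p, hp⟩ : ∃ p : ℝ → ℝ, ∀ s, p s = inner ℝ (f s) (h s) := ⟨_, fun _ => rfl⟩
  have hpc : ContinuousOn p (Icc a' c) := by
    rw [show p = fun s => inner ℝ (f s) (h s) from funext hp]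
    exact hfc.continuousOn.inner hhc
  have hpabs : ∀ s, |p s| ≤ ‖h s‖ * ‖f s‖ := fun s => by
    rw [hp, mul_comm]; exact abs_real_inner_le_norm _ _
  obtain ⟨N, hN⟩ : ∃ N : ℝ → ℝ, ∀ s, N s = ‖f s‖ ^ 2 := ⟨_, fun _ => rfl⟩
  have hN0 : ∀ s, 0 ≤ N s := fun s => by rw [hN]; positivity
  have hNc : Continuous N := by
    rw [show N = fun s => ‖f s‖ ^ 2 from funext hN]; fun_prop
  have hfd : ∀ s, deriv f s = h s + ((s - a)⁻¹ / 2) • f s := fun s => by rw [hh]; abel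
  have hN' : ∀ s, HasDerivAt N (2 * p s + (s - a)⁻¹ * N s) s := by
    intro s
    have := (hf' s).norm_sq
    rw [hfd, inner_add_right, inner_smul_right, real_inner_self_eq_norm_sq, ← hp, ← hN] at this
    rw [show N = fun s => ‖f s‖ ^ 2 from funext hN]
    convert this using 1
    simp only [← hN]
    ring
  set m : ℝ := q / 4 with hm
  have hm1 : 1 ≤ m := by rw [hm]; linarith
  obtain ⟨P, hP⟩ : ∃ P : ℝ → ℝ, ∀ s, P s = ‖f s‖ ^ (2 * m - 1) := ⟨_, fun _ => rfl⟩
  have hPc : Continuous P := by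
    rw [show P = fun s => ‖f s‖ ^ (2 * m - 1) from funext hP]
    exact hfc.norm.rpow_const fun _ => Or.inr (by linarith)
  have hP0 : ∀ s, 0 ≤ P s := fun s => by rw [hP]; positivity
  have hNm : ∀ s, N s ^ m = ‖f s‖ ^ (q / 2) := fun s => by
    rw [hN, ← Real.rpow_natCast_mul (norm_nonneg _)]; congr 1; rw [hm]; push_cast; ring
  have hNP : ∀ s, ‖f s‖ * N s ^ (m - 1) = P s := fun s => by
    rw [hN, hP, ← Real.rpow_natCast_mul (norm_nonneg _)]
    rcases eq_or_ne (‖f s‖) 0 with hz | hz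
    · rw [hz, zero_mul, Real.zero_rpow (by linarith)]
    · rw [show (2 * m - 1) = 1 + ((2 : ℕ) : ℝ) * (m - 1) by push_cast; ring,
        Real.rpow_add (by positivity), Real.rpow_one]
  have hNm1 : ∀ s, N s * N s ^ (m - 1) = N s ^ m := fun s => by
    rcases eq_or_ne (N s) 0 with hz | hz
    · rw [hz, zero_mul, Real.zero_rpow (by linarith)]
    · rw [Real.rpow_sub_one hz]; field_simp
  have hNmP : ∀ s, N s ^ m = ‖f s‖ * P s := fun s => by
    rw [← hNm1, ← hNP, hN]; ring
  have hNmc : Continuous fun s => N s ^ m := hNc.rpow_const fun _ => Or.inr (by linarith)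
  have hNm1c : Continuous fun s => N s ^ (m - 1) := hNc.rpow_const fun _ => Or.inr (by linarith)
  have hF' : ∀ s, HasDerivAt (fun s => N s ^ m)
      (m * (2 * (p s * N s ^ (m - 1)) + (s - a)⁻¹ * N s ^ m)) s := by
    intro s
    convert (hN' s).rpow_const (p := m) (Or.inr hm1) using 1
    rw [← hNm1]; ring
  have hpN : ∀ s, |p s * N s ^ (m - 1)| ≤ ‖h s‖ * P s := fun s => by
    rw [abs_mul, abs_of_nonneg (Real.rpow_nonneg (hN0 s) _), ← hNP, ← mul_assoc]
    exact mul_le_mul_of_nonneg_right (hpabs s) (Real.rpow_nonneg (hN0 s) _)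
  have hNa : N a' = 0 := by rw [hN, h0]; simp
  have hmne : m ≠ 0 := by linarith
  obtain ⟨A, hA⟩ : ∃ A, A = ∫ s in a'..c, ‖h s‖ ^ 2 := ⟨_, rfl⟩
  obtain ⟨J, hJ⟩ : ∃ J, J = ∫ s in a'..c, ‖f s‖ ^ 2 := ⟨_, rfl⟩
  have hBP : B = ∫ s in a'..c, P s ^ 2 := by
    rw [hB]; congr 1; ext s
    rw [hP, ← Real.rpow_mul_natCast (norm_nonneg _)]; congr 1; rw [hm]; push_cast; ring
  have hA0 : 0 ≤ A := by
    rw [hA]; exact intervalIntegral.integral_nonneg hac fun s _ => sq_nonneg _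
  have hJ0 : 0 ≤ J := by
    rw [hJ]; exact intervalIntegral.integral_nonneg hac fun s _ => sq_nonneg _
  have csA : ∫ s in a'..c, ‖h s‖ * P s ≤ √A * √B := by
    rw [hA, hBP]
    exact intervalIntegral_mul_le_sqrt_mul_sqrt hac hhc.norm hPc.continuousOn
  have csJ : ∫ s in a'..c, ‖f s‖ * P s ≤ √J * √B := by
    rw [hJ, hBP]
    exact intervalIntegral_mul_le_sqrt_mul_sqrt hac hfc.norm.continuousOn hPc.continuousOn
  have csAJ : ∫ s in a'..c, ‖h s‖ * ‖f s‖ ≤ √A * √J := by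
    rw [hA, hJ]
    exact intervalIntegral_mul_le_sqrt_mul_sqrt hac hhc.norm hfc.norm.continuousOn
  have hhP : ContinuousOn (fun s => ‖h s‖ * P s) (Icc a' c) := hhc.norm.mul hPc.continuousOn
  set l := c - a with hl
  have hl0 : 0 < l := by rw [hl]; linarith
  -- the Hardy energy in terms of `h`
  have hEA : E = A + N c / (2 * l) := by
    have hM : ∀ s ∈ uIcc a' c, HasDerivAt (fun s => (s - a)⁻¹ * N s / 2)
        ((s - a)⁻¹ * p s) s := by
      intro s hs
      rw [uIcc_of_le hac] at hs
      have h1 : HasDerivAt (fun s => (s - a)⁻¹ * N s / 2) _ s :=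
        ((((hasDerivAt_id' s).sub_const a).inv (hne s hs)).mul (hN' s)).div_const 2
      refine h1.congr_deriv ?_
      have := hne s hs
      simp only [Pi.inv_apply]
      field_simp
      ring
    have hi1 : IntervalIntegrable (fun s => ‖h s‖ ^ 2) volume a' c := hI (hhc.norm.pow 2)
    have hi2 : IntervalIntegrable (fun s => (s - a)⁻¹ * p s) volume a' c := hI (hw.mul hpc)
    have h1 := intervalIntegral.integral_eq_sub_of_hasDerivAt hM hi2
    rw [hNa] at h1
    rw [hE, hA, show N c / (2 * l) = (c - a)⁻¹ * N c / 2 - (a' - a)⁻¹ * 0 / 2 by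
      rw [hl]; field_simp; ring, ← h1, ← intervalIntegral.integral_add hi1 hi2]
    apply intervalIntegral.integral_congr
    intro s hs
    rw [uIcc_of_le hac] at hs
    have := hne s hs
    simp only
    rw [hfd, norm_add_sq_real, inner_smul_right, real_inner_comm, ← hp, norm_smul,
      Real.norm_eq_abs, mul_pow, sq_abs]
    field_simp
    ring
  have hEA' : A ≤ E := by
    rw [hEA]; have := hN0 c; linarith [div_nonneg this (by positivity : 0 ≤ 2 * l)]
  have hE0 : 0 ≤ E := hA0.trans hEA'
  -- the `L²` bound
  have hJb : J ≤ l * N c / 2 + l * (√A * √J) := by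
    have hM : ∀ s ∈ uIcc a' c, HasDerivAt (fun s => (s - a) * N s / 2)
        (N s + (s - a) * p s) s := by
      intro s hs
      rw [uIcc_of_le hac] at hs
      have h1 : HasDerivAt (fun s => (s - a) * N s / 2) _ s :=
        (((hasDerivAt_id' s).sub_const a).mul (hN' s)).div_const 2
      refine h1.congr_deriv ?_
      have := hne s hs
      field_simp
      ring
    have hc1 : ContinuousOn (fun s => (s - a) * p s) (Icc a' c) :=
      (Continuous.continuousOn (by fun_prop)).mul hpc
    have h1 := intervalIntegral.integral_eq_sub_of_hasDerivAt hM
      (hI (hNc.continuousOn.add hc1))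
    rw [hNa, intervalIntegral.integral_add (hI hNc.continuousOn) (hI hc1),
      show ∫ s in a'..c, N s = J by rw [hJ]; simp only [hN]] at h1
    have hc2 : ContinuousOn (fun s => (-l) * (‖h s‖ * ‖f s‖)) (Icc a' c) :=
      continuousOn_const.mul (hhc.norm.mul hfc.norm.continuousOn)
    have h2 : ∫ s in a'..c, (-l) * (‖h s‖ * ‖f s‖) ≤ ∫ s in a'..c, (s - a) * p s := by
      apply intervalIntegral.integral_mono_on hac (hI hc2) (hI hc1)
      intro s hs
      have h3 := neg_le_of_abs_le (hpabs s)
      have h4 := hpos s hs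
      have h5 : s - a ≤ l := by rw [hl]; linarith [hs.2]
      have h6 : 0 ≤ ‖h s‖ * ‖f s‖ := by positivity
      nlinarith [mul_le_mul_of_nonneg_right h5 h6, mul_le_mul_of_nonneg_left h3 h4.le]
    rw [intervalIntegral.integral_const_mul] at h2
    have h3 := mul_le_mul_of_nonneg_left csAJ hl0.le
    rw [← hl] at h1
    linarith
  -- the value at the endpoint
  have hFc : l * N c ^ m ≤ (1 + m) * (√J * √B) + 2 * m * l * (√A * √B) := by
    have hM : ∀ s ∈ uIcc a' c, HasDerivAt (fun s => (s - a) * N s ^ m)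
        ((1 + m) * (‖f s‖ * P s) + 2 * m * ((s - a) * (p s * N s ^ (m - 1)))) s := by
      intro s hs
      rw [uIcc_of_le hac] at hs
      have h1 : HasDerivAt (fun s => (s - a) * N s ^ m) _ s :=
        ((hasDerivAt_id' s).sub_const a).mul (hF' s)
      refine h1.congr_deriv ?_
      have := hne s hs
      rw [← hNmP]
      field_simp
      ring
    have hc1 : ContinuousOn (fun s => (1 + m) * (‖f s‖ * P s)) (Icc a' c) := by fun_prop
    have hc2 : ContinuousOn (fun s => 2 * m * ((s - a) * (p s * N s ^ (m - 1)))) (Icc a' c) :=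
      continuousOn_const.mul ((Continuous.continuousOn (by fun_prop)).mul
        (hpc.mul hNm1c.continuousOn))
    have h1 := intervalIntegral.integral_eq_sub_of_hasDerivAt hM (hI (hc1.add hc2))
    rw [hNa, Real.zero_rpow hmne, intervalIntegral.integral_add (hI hc1) (hI hc2),
      intervalIntegral.integral_const_mul] at h1
    have hc3 : ContinuousOn (fun s => (2 * m * l) * (‖h s‖ * P s)) (Icc a' c) :=
      continuousOn_const.mul hhP
    have h2 : ∫ s in a'..c, 2 * m * ((s - a) * (p s * N s ^ (m - 1)))
        ≤ ∫ s in a'..c, (2 * m * l) * (‖h s‖ * P s) := by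
      apply intervalIntegral.integral_mono_on hac (hI hc2) (hI hc3)
      intro s hs
      have h3 := le_of_abs_le (hpN s)
      have h4 := hpos s hs
      have h5 : s - a ≤ l := by rw [hl]; linarith [hs.2]
      have h6 : 0 ≤ ‖h s‖ * P s := mul_nonneg (norm_nonneg _) (hP0 s)
      rw [mul_assoc (2 * m)]
      exact mul_le_mul_of_nonneg_left ((mul_le_mul_of_nonneg_left h3 h4.le).trans
        (mul_le_mul_of_nonneg_right h5 h6)) (by linarith)
    rw [intervalIntegral.integral_const_mul (2 * m * l)] at h2
    have h3 := mul_le_mul_of_nonneg_left csA (by positivity : 0 ≤ 2 * m * l)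
    have h4 := mul_le_mul_of_nonneg_left csJ (by positivity : 0 ≤ 1 + m)
    rw [← hl] at h1
    linarith
  refine ⟨hE0, ?_, ?_⟩
  · rw [← hNm]
    obtain ⟨u, hu⟩ : ∃ u, u = √J / l := ⟨_, rfl⟩
    have huJ : √J = u * l := by rw [hu]; field_simp
    have hu0 : 0 ≤ u := by rw [hu]; positivity
    have hsA := Real.sqrt_nonneg A
    have hsB := Real.sqrt_nonneg B
    have hA2 := Real.sq_sqrt hA0
    have h1 : u ^ 2 - u * √A + √A ^ 2 ≤ E := by
      have h2 : J = (u * l) ^ 2 := by rw [← huJ, Real.sq_sqrt hJ0]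
      rw [huJ, h2] at hJb
      have h3 : u ^ 2 ≤ N c / (2 * l) + √A * u := by
        have h4 : u ^ 2 * l ^ 2 ≤ (N c / (2 * l) + √A * u) * l ^ 2 := by
          have : (N c / (2 * l) + √A * u) * l ^ 2 = l * N c / 2 + l * (√A * (u * l)) := by
            field_simp
          rw [this]; linarith
        exact le_of_mul_le_mul_right h4 (by positivity)
      rw [hEA, hA2]; linarith
    have h2 : u + √A ≤ 2 * √E := by
      have : (u + √A) / 2 ≤ √E := by
        apply Real.le_sqrt_of_sq_le
        nlinarith [sq_nonneg (u - √A)]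
      linarith
    have h3 : N c ^ m ≤ (1 + m) * (u * √B) + 2 * m * (√A * √B) := by
      rw [huJ] at hFc
      have : l * N c ^ m ≤ l * ((1 + m) * (u * √B) + 2 * m * (√A * √B)) := by linarith
      exact le_of_mul_le_mul_left this hl0
    have h4 : (1 + m) * (u * √B) ≤ 2 * m * (u * √B) :=
      mul_le_mul_of_nonneg_right (by linarith) (by positivity)
    have h5 := mul_le_mul_of_nonneg_left (mul_le_mul_of_nonneg_right h2 hsB)
      (by linarith : 0 ≤ 2 * m)
    have h6 : q = 4 * m := by rw [hm]; ring
    rw [h6]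
    linarith
  · intro x hx
    rw [← hNm, ← hNm]
    have hsub : Icc x c ⊆ Icc a' c := Icc_subset_Icc_left hx.1
    have hcF : ContinuousOn (fun s => m * (2 * (p s * N s ^ (m - 1)) + (s - a)⁻¹ * N s ^ m))
        (Icc a' c) :=
      continuousOn_const.mul ((continuousOn_const.mul (hpc.mul hNm1c.continuousOn)).add
        (hw.mul hNmc.continuousOn))
    have h1 := intervalIntegral.integral_eq_sub_of_hasDerivAt (fun s (_ : s ∈ uIcc x c) => hF' s)
      ((hcF.mono hsub).intervalIntegrable_of_Icc hx.2)
    have hcP : ContinuousOn (fun s => (-(2 * m)) * (‖h s‖ * P s)) (Icc a' c) :=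
      continuousOn_const.mul hhP
    have h2 : ∫ s in x..c, (-(2 * m)) * (‖h s‖ * P s)
        ≤ ∫ s in x..c, m * (2 * (p s * N s ^ (m - 1)) + (s - a)⁻¹ * N s ^ m) := by
      apply intervalIntegral.integral_mono_on hx.2
        ((hcP.mono hsub).intervalIntegrable_of_Icc hx.2)
        ((hcF.mono hsub).intervalIntegrable_of_Icc hx.2)
      intro s hs
      have h3 := neg_le_of_abs_le (hpN s)
      have h4 : 0 ≤ (s - a)⁻¹ * N s ^ m :=
        mul_nonneg (inv_nonneg.2 (hpos s (hsub hs)).le) (Real.rpow_nonneg (hN0 s) _)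
      have h5 := mul_le_mul_of_nonneg_left h3 (by linarith : 0 ≤ m)
      have h6 := mul_nonneg (by linarith : 0 ≤ m) h4
      linarith
    rw [intervalIntegral.integral_const_mul] at h2
    have h3 : ∫ s in x..c, ‖h s‖ * P s ≤ ∫ s in a'..c, ‖h s‖ * P s :=
      intervalIntegral.integral_mono_interval hx.1 hx.2 le_rfl
        (Filter.Eventually.of_forall fun s => mul_nonneg (norm_nonneg _) (hP0 s)) (hI hhP)
    have h4 : √A * √B ≤ √E * √B :=
      mul_le_mul_of_nonneg_right (Real.sqrt_le_sqrt hEA') (Real.sqrt_nonneg _)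
    have h5 := mul_le_mul_of_nonneg_left (h3.trans (csA.trans h4)) (by linarith : 0 ≤ 2 * m)
    have h6 : q / 2 = 2 * m := by rw [hm]; ring
    rw [h6]
    linarith

/-- `hardy_sobolev_half` for a function vanishing near the singular point `a`. -/
theorem hardy_sobolev_left {q : ℝ} (hq : 4 ≤ q) {f : ℝ → ℂ} (hf : ContDiff ℝ 1 f) {a c : ℝ}
    (hac : a < c) (h0 : f =ᶠ[nhds a] 0) {E B : ℝ}
    (hE : E = ∫ s in a..c, (‖deriv f s‖ ^ 2 - ‖f s‖ ^ 2 / (4 * (s - a) ^ 2)))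
    (hB : B = ∫ s in a..c, ‖f s‖ ^ (q - 2)) :
    0 ≤ E ∧ ‖f c‖ ^ (q / 2) ≤ q * (√E * √B) ∧
      ∀ x ∈ Icc a c, ‖f x‖ ^ (q / 2) ≤ ‖f c‖ ^ (q / 2) + q / 2 * (√E * √B) := by
  obtain ⟨ε, hε, hball⟩ := Metric.eventually_nhds_iff.1 (h0.and h0.deriv)
  obtain ⟨a', haa', ha'⟩ := exists_between (lt_min hac (lt_add_of_pos_right a hε))
  have ha'c : a' < c := ha'.trans_le (min_le_left _ _)
  have hz : ∀ s ∈ Icc a a', f s = 0 ∧ deriv f s = 0 := by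
    intro s hs
    have hlt : s < a + ε := hs.2.trans_lt (ha'.trans_le (min_le_right _ _))
    have hd : dist s a < ε := by
      rw [Real.dist_eq, abs_of_nonneg (by linarith [hs.1])]; linarith
    simpa using hball hd
  have hcut : ∀ g : ℝ → ℝ, (∀ s ∈ Icc a a', g s = 0) → ∫ s in a..c, g s = ∫ s in a'..c, g s := by
    intro g hg
    rw [intervalIntegral.integral_of_le hac.le, intervalIntegral.integral_of_le ha'c.le]
    apply setIntegral_eq_of_subset_of_forall_sdiff_eq_zero measurableSet_Ioc
      (Ioc_subset_Ioc_left haa'.le)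
    intro s hs
    refine hg s ⟨hs.1.1.le, ?_⟩
    by_contra hlt
    exact hs.2 ⟨not_le.1 hlt, hs.1.2⟩
  rw [hcut _ fun s hs => by simp [hz s hs]] at hE
  rw [hcut _ fun s hs => by
    rw [(hz s hs).1, norm_zero, Real.zero_rpow (by linarith)]] at hB
  obtain ⟨h1, h2, h3⟩ := hardy_sobolev_half hq hf haa' ha'c.le (hz a' ⟨haa'.le, le_rfl⟩).1 hE hB
  refine ⟨h1, h2, fun x hx => ?_⟩
  rcases le_total a' x with hx' | hx'
  · exact h3 x ⟨hx', hx.2⟩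
  · rw [(hz x ⟨hx.1, hx'⟩).1, norm_zero, Real.zero_rpow (by linarith)]
    positivity

/-- The reflection of `hardy_sobolev_left`. -/
theorem hardy_sobolev_right {q : ℝ} (hq : 4 ≤ q) {f : ℝ → ℂ} (hf : ContDiff ℝ 1 f) {b c : ℝ}
    (hcb : c < b) (h0 : f =ᶠ[nhds b] 0) {E B : ℝ}
    (hE : E = ∫ s in c..b, (‖deriv f s‖ ^ 2 - ‖f s‖ ^ 2 / (4 * (b - s) ^ 2)))
    (hB : B = ∫ s in c..b, ‖f s‖ ^ (q - 2)) :
    0 ≤ E ∧ ‖f c‖ ^ (q / 2) ≤ q * (√E * √B) ∧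
      ∀ x ∈ Icc c b, ‖f x‖ ^ (q / 2) ≤ ‖f c‖ ^ (q / 2) + q / 2 * (√E * √B) := by
  have hg0 : (fun s => f (-s)) =ᶠ[nhds (-b)] 0 := by
    have : Filter.Tendsto (fun s : ℝ => -s) (nhds (-b)) (nhds b) := by
      simpa using (continuous_neg.tendsto (-b))
    exact this.eventually h0
  have hE' : E = ∫ s in -b..-c, (‖deriv (fun s => f (-s)) s‖ ^ 2
      - ‖f (-s)‖ ^ 2 / (4 * (s - -b) ^ 2)) := by
    rw [hE]
    have := intervalIntegral.integral_comp_neg (a := -b) (b := -c)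
      (fun s => ‖deriv f s‖ ^ 2 - ‖f s‖ ^ 2 / (4 * (b - s) ^ 2))
    rw [neg_neg, neg_neg] at this
    rw [← this]
    congr 1; ext s
    rw [deriv_comp_neg, norm_neg]
    ring_nf
  have hB' : B = ∫ s in -b..-c, ‖f (-s)‖ ^ (q - 2) := by
    rw [hB]
    have := intervalIntegral.integral_comp_neg (a := -b) (b := -c) (fun s => ‖f s‖ ^ (q - 2))
    rw [neg_neg, neg_neg] at this
    exact this.symm
  obtain ⟨h1, h2, h3⟩ := hardy_sobolev_left hq (hf.comp contDiff_neg) (neg_lt_neg hcb) hg0 hE' hB'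
  simp only [Function.comp_apply, neg_neg] at h2 h3
  refine ⟨h1, h2, fun x hx => ?_⟩
  simpa using h3 (-x) ⟨neg_le_neg hx.2, neg_le_neg hx.1⟩

/-- The Hardy–Sobolev inequality on a set `C`, together with nonnegativity of the Hardy energy
density `φ` integrated over `C`. -/
def HardySobolevOn (q : ℝ) (f : ℝ → ℂ) (φ : ℝ → ℝ) (C : Set ℝ) : Prop :=
  0 ≤ ∫ s in C, φ s ∧ ∀ x ∈ C, ‖f x‖ ^ (q / 2) ≤
    q * (√(∫ s in C, φ s) * √(∫ s in C, ‖f s‖ ^ (q - 2)))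

theorem infDist_compl_Icc {Ω : Set ℝ} {a b s : ℝ} (ha : a ∉ Ω) (hb : b ∉ Ω) (hab : Ioo a b ⊆ Ω)
    (hs : s ∈ Icc a b) : infDist s Ωᶜ = min (s - a) (b - s) := by
  apply le_antisymm
  · apply le_min
    · have := infDist_le_dist_of_mem (x := s) (s := Ωᶜ) ha
      rwa [Real.dist_eq, abs_of_nonneg (by linarith [hs.1])] at this
    · have := infDist_le_dist_of_mem (x := s) (s := Ωᶜ) hb
      rwa [dist_comm, Real.dist_eq, abs_of_nonneg (by linarith [hs.2])] at this
  · rw [le_infDist ⟨a, ha⟩]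
    intro y hy
    rcases le_or_gt y a with h | h
    · exact (min_le_left _ _).trans ((by linarith : s - a ≤ s - y).trans (le_abs_self _))
    · have h' : b ≤ y := not_lt.1 fun h' => hy (hab ⟨h, h'⟩)
      rw [dist_comm]
      exact (min_le_right _ _).trans ((by linarith : b - s ≤ y - s).trans (le_abs_self _))

theorem infDist_compl_Ici {Ω : Set ℝ} {a s : ℝ} (ha : a ∉ Ω) (hab : Ioi a ⊆ Ω)
    (hs : a ≤ s) : infDist s Ωᶜ = s - a := by
  apply le_antisymm
  · have := infDist_le_dist_of_mem (x := s) (s := Ωᶜ) ha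
    rwa [Real.dist_eq, abs_of_nonneg (by linarith)] at this
  · rw [le_infDist ⟨a, ha⟩]
    intro y hy
    have h : y ≤ a := not_lt.1 fun h => hy (hab h)
    exact (by linarith : s - a ≤ s - y).trans (le_abs_self _)

theorem infDist_compl_Iic {Ω : Set ℝ} {b s : ℝ} (hb : b ∉ Ω) (hab : Iio b ⊆ Ω)
    (hs : s ≤ b) : infDist s Ωᶜ = b - s := by
  apply le_antisymm
  · have := infDist_le_dist_of_mem (x := s) (s := Ωᶜ) hb
    rwa [dist_comm, Real.dist_eq, abs_of_nonneg (by linarith)] at this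
  · rw [le_infDist ⟨b, hb⟩]
    intro y hy
    have h : b ≤ y := not_lt.1 fun h => hy (hab h)
    rw [dist_comm]
    exact (by linarith : b - s ≤ y - s).trans (le_abs_self _)

section Components

variable {q : ℝ} {f : ℝ → ℂ} {Ω : Set ℝ} {φ : ℝ → ℝ}

theorem hardySobolevOn_Ioo (hq : 4 ≤ q) (hf : ContDiff ℝ 1 f) (hsub : tsupport f ⊆ Ω)
    (hφ : ∀ s, φ s = ‖deriv f s‖ ^ 2 - ‖f s‖ ^ 2 / (4 * infDist s Ωᶜ ^ 2))
    (hφi : Integrable φ) {a b : ℝ} (hlt : a < b) (ha : a ∉ Ω) (hb : b ∉ Ω) (hab : Ioo a b ⊆ Ω) :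
    HardySobolevOn q f φ (Ioo a b) := by
  have ha0 := notMem_tsupport_iff_eventuallyEq.1 fun h => ha (hsub h)
  have hb0 := notMem_tsupport_iff_eventuallyEq.1 fun h => hb (hsub h)
  have hgc : Continuous fun s => ‖f s‖ ^ (q - 2) :=
    hf.continuous.norm.rpow_const fun _ => Or.inr (by linarith)
  obtain ⟨c, hc⟩ : ∃ c, c = (a + b) / 2 := ⟨_, rfl⟩
  have hac : a < c := by linarith
  have hcb : c < b := by linarith
  have hE1 : ∫ s in a..c, φ s =
      ∫ s in a..c, (‖deriv f s‖ ^ 2 - ‖f s‖ ^ 2 / (4 * (s - a) ^ 2)) := by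
    apply intervalIntegral.integral_congr
    intro s hs
    rw [uIcc_of_le hac.le] at hs
    simp only
    rw [hφ, infDist_compl_Icc ha hb hab ⟨hs.1, hs.2.trans hcb.le⟩, min_eq_left (by linarith [hs.2])]
  have hE2 : ∫ s in c..b, φ s =
      ∫ s in c..b, (‖deriv f s‖ ^ 2 - ‖f s‖ ^ 2 / (4 * (b - s) ^ 2)) := by
    apply intervalIntegral.integral_congr
    intro s hs
    rw [uIcc_of_le hcb.le] at hs
    simp only
    rw [hφ, infDist_compl_Icc ha hb hab ⟨hac.le.trans hs.1, hs.2⟩, min_eq_right (by linarith [hs.1])]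
  obtain ⟨l1, l2, l3⟩ := hardy_sobolev_left hq hf hac ha0 hE1 rfl
  obtain ⟨r1, r2, r3⟩ := hardy_sobolev_right hq hf hcb hb0 hE2 rfl
  have hBl : 0 ≤ ∫ s in a..c, ‖f s‖ ^ (q - 2) :=
    intervalIntegral.integral_nonneg hac.le fun s _ => by positivity
  have hBr : 0 ≤ ∫ s in c..b, ‖f s‖ ^ (q - 2) :=
    intervalIntegral.integral_nonneg hcb.le fun s _ => by positivity
  have hE : ∫ s in Ioo a b, φ s = (∫ s in a..c, φ s) + ∫ s in c..b, φ s := by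
    rw [intervalIntegral.integral_add_adjacent_intervals hφi.intervalIntegrable
      hφi.intervalIntegrable, intervalIntegral.integral_of_le hlt.le, integral_Ioc_eq_integral_Ioo]
  have hB : ∫ s in Ioo a b, ‖f s‖ ^ (q - 2) =
      (∫ s in a..c, ‖f s‖ ^ (q - 2)) + ∫ s in c..b, ‖f s‖ ^ (q - 2) := by
    rw [intervalIntegral.integral_add_adjacent_intervals (hgc.intervalIntegrable _ _)
      (hgc.intervalIntegrable _ _), intervalIntegral.integral_of_le hlt.le,
      integral_Ioc_eq_integral_Ioo]
  rw [HardySobolevOn, hE, hB]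
  generalize (∫ s in a..c, φ s) = E₁ at *
  generalize (∫ s in c..b, φ s) = E₂ at *
  generalize (∫ s in a..c, ‖f s‖ ^ (q - 2)) = B₁ at *
  generalize (∫ s in c..b, ‖f s‖ ^ (q - 2)) = B₂ at *
  refine ⟨add_nonneg l1 r1, fun x hx => ?_⟩
  have hcs : √E₁ * √B₁ + √E₂ * √B₂ ≤ √(E₁ + E₂) * √(B₁ + B₂) := by
    rw [← Real.sqrt_mul (add_nonneg l1 r1)]
    apply Real.le_sqrt_of_sq_le
    have e1 := Real.sq_sqrt l1
    have e2 := Real.sq_sqrt r1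
    have e3 := Real.sq_sqrt hBl
    have e4 := Real.sq_sqrt hBr
    calc (√E₁ * √B₁ + √E₂ * √B₂) ^ 2
        ≤ (√E₁ ^ 2 + √E₂ ^ 2) * (√B₁ ^ 2 + √B₂ ^ 2) := by
          linarith [sq_nonneg (√E₁ * √B₂ - √E₂ * √B₁)]
      _ = (E₁ + E₂) * (B₁ + B₂) := by rw [e1, e2, e3, e4]
  have hcs1 : √E₁ * √B₁ ≤ √(E₁ + E₂) * √(B₁ + B₂) := by
    have : 0 ≤ √E₂ * √B₂ := by positivity
    linarith
  have hcs2 : √E₂ * √B₂ ≤ √(E₁ + E₂) * √(B₁ + B₂) := by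
    have : 0 ≤ √E₁ * √B₁ := by positivity
    linarith
  have hq2 : 0 ≤ q / 2 := by linarith
  have k := mul_le_mul_of_nonneg_left hcs hq2
  have k1 := mul_le_mul_of_nonneg_left hcs1 hq2
  have k2 := mul_le_mul_of_nonneg_left hcs2 hq2
  rcases le_total x c with h | h
  · have := l3 x ⟨hx.1.le, h⟩
    linarith
  · have := r3 x ⟨h, hx.2.le⟩
    linarith

theorem eq_zero_of_compl_tsupport (hφ : ∀ s, φ s = ‖deriv f s‖ ^ 2
    - ‖f s‖ ^ 2 / (4 * infDist s Ωᶜ ^ 2)) {s : ℝ} (hs : s ∉ tsupport f) :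
    f s = 0 ∧ φ s = 0 := by
  have h := notMem_tsupport_iff_eventuallyEq.1 hs
  have h1 : f s = 0 := h.self_of_nhds
  have h2 : deriv f s = 0 := by simpa using h.deriv_eq
  exact ⟨h1, by rw [hφ, h1, h2]; simp⟩

theorem hardySobolevOn_Ioi (hq : 4 ≤ q) (hf : ContDiff ℝ 1 f) (hsupp : HasCompactSupport f)
    (hsub : tsupport f ⊆ Ω)
    (hφ : ∀ s, φ s = ‖deriv f s‖ ^ 2 - ‖f s‖ ^ 2 / (4 * infDist s Ωᶜ ^ 2))
    {a : ℝ} (ha : a ∉ Ω) (hab : Ioi a ⊆ Ω) :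
    HardySobolevOn q f φ (Ioi a) := by
  have ha0 := notMem_tsupport_iff_eventuallyEq.1 fun h => ha (hsub h)
  obtain ⟨M, hM⟩ := hsupp.isCompact.bddAbove
  obtain ⟨X, hX⟩ : ∃ X, X = max a M + 1 := ⟨_, rfl⟩
  have haX : a < X := by linarith [le_max_left a M]
  have hz : ∀ s, X ≤ s → f s = 0 ∧ φ s = 0 := fun s hs =>
    eq_zero_of_compl_tsupport hφ fun h => by linarith [hM h, le_max_right a M]
  have hcut : ∀ g : ℝ → ℝ, (∀ s, X ≤ s → g s = 0) → ∫ s in Ioi a, g s = ∫ s in a..X, g s := by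
    intro g hg
    rw [intervalIntegral.integral_of_le haX.le]
    apply setIntegral_eq_of_subset_of_forall_sdiff_eq_zero measurableSet_Ioi Ioc_subset_Ioi_self
    intro s hs
    exact hg s (not_lt.1 fun h => hs.2 ⟨hs.1, h.le⟩)
  have hE : ∫ s in Ioi a, φ s =
      ∫ s in a..X, (‖deriv f s‖ ^ 2 - ‖f s‖ ^ 2 / (4 * (s - a) ^ 2)) := by
    rw [hcut φ fun s hs => (hz s hs).2]
    apply intervalIntegral.integral_congr
    intro s hs
    rw [uIcc_of_le haX.le] at hs
    simp only
    rw [hφ, infDist_compl_Ici ha hab hs.1]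
  have hB := hcut (fun s => ‖f s‖ ^ (q - 2)) fun s hs => by
    rw [(hz s hs).1, norm_zero, Real.zero_rpow (by linarith)]
  obtain ⟨l1, l2, l3⟩ := hardy_sobolev_left hq hf haX ha0 hE hB
  refine ⟨l1, fun x hx => ?_⟩
  rcases le_total x X with h | h
  · have h3 := l3 x ⟨hx.le, h⟩
    rw [(hz X le_rfl).1, norm_zero, Real.zero_rpow (by linarith), zero_add] at h3
    exact h3.trans (mul_le_mul_of_nonneg_right (by linarith) (by positivity))
  · rw [(hz x h).1, norm_zero, Real.zero_rpow (by linarith)]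
    positivity

theorem hardySobolevOn_Iio (hq : 4 ≤ q) (hf : ContDiff ℝ 1 f) (hsupp : HasCompactSupport f)
    (hsub : tsupport f ⊆ Ω)
    (hφ : ∀ s, φ s = ‖deriv f s‖ ^ 2 - ‖f s‖ ^ 2 / (4 * infDist s Ωᶜ ^ 2))
    {b : ℝ} (hb : b ∉ Ω) (hab : Iio b ⊆ Ω) :
    HardySobolevOn q f φ (Iio b) := by
  have hb0 := notMem_tsupport_iff_eventuallyEq.1 fun h => hb (hsub h)
  obtain ⟨M, hM⟩ := hsupp.isCompact.bddBelow
  obtain ⟨X, hX⟩ : ∃ X, X = min b M - 1 := ⟨_, rfl⟩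
  have hXb : X < b := by linarith [min_le_left b M]
  have hz : ∀ s, s ≤ X → f s = 0 ∧ φ s = 0 := fun s hs =>
    eq_zero_of_compl_tsupport hφ fun h => by linarith [hM h, min_le_right b M]
  have hcut : ∀ g : ℝ → ℝ, (∀ s, s ≤ X → g s = 0) → ∫ s in Iio b, g s = ∫ s in X..b, g s := by
    intro g hg
    rw [intervalIntegral.integral_of_le hXb.le, integral_Ioc_eq_integral_Ioo]
    apply setIntegral_eq_of_subset_of_forall_sdiff_eq_zero measurableSet_Iio Ioo_subset_Iio_self
    intro s hs
    exact hg s (not_lt.1 fun h => hs.2 ⟨h, hs.1⟩)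
  have hE : ∫ s in Iio b, φ s =
      ∫ s in X..b, (‖deriv f s‖ ^ 2 - ‖f s‖ ^ 2 / (4 * (b - s) ^ 2)) := by
    rw [hcut φ fun s hs => (hz s hs).2]
    apply intervalIntegral.integral_congr
    intro s hs
    rw [uIcc_of_le hXb.le] at hs
    simp only
    rw [hφ, infDist_compl_Iic hb hab hs.2]
  have hB := hcut (fun s => ‖f s‖ ^ (q - 2)) fun s hs => by
    rw [(hz s hs).1, norm_zero, Real.zero_rpow (by linarith)]
  obtain ⟨l1, l2, l3⟩ := hardy_sobolev_right hq hf hXb hb0 hE hB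
  refine ⟨l1, fun x hx => ?_⟩
  rcases le_total X x with h | h
  · have h3 := l3 x ⟨h, hx.le⟩
    rw [(hz X le_rfl).1, norm_zero, Real.zero_rpow (by linarith), zero_add] at h3
    exact h3.trans (mul_le_mul_of_nonneg_right (by linarith) (by positivity))
  · rw [(hz x h).1, norm_zero, Real.zero_rpow (by linarith)]
    positivity

end Components

theorem exists_left_endpoint {Ω : Set ℝ} (hΩ : IsOpen Ω) {t : ℝ} (ht : t ∈ Ω) :
    Iic t ⊆ Ω ∨ ∃ a, a < t ∧ a ∉ Ω ∧ Ioc a t ⊆ Ω := by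
  by_cases h : (Ωᶜ ∩ Iic t).Nonempty
  · right
    have hbd : BddAbove (Ωᶜ ∩ Iic t) := ⟨t, fun x hx => hx.2⟩
    have hm := (hΩ.isClosed_compl.inter isClosed_Iic).csSup_mem h hbd
    refine ⟨_, lt_of_le_of_ne hm.2 fun he => hm.1 (by rw [he]; exact ht), hm.1, fun x hx => ?_⟩
    by_contra hx'
    exact absurd (le_csSup hbd ⟨hx', hx.2⟩) (not_le.2 hx.1)
  · left
    intro x hx
    by_contra hx'
    exact h ⟨x, hx', hx⟩

theorem exists_right_endpoint {Ω : Set ℝ} (hΩ : IsOpen Ω) {t : ℝ} (ht : t ∈ Ω) :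
    Ici t ⊆ Ω ∨ ∃ b, t < b ∧ b ∉ Ω ∧ Ico t b ⊆ Ω := by
  by_cases h : (Ωᶜ ∩ Ici t).Nonempty
  · right
    have hbd : BddBelow (Ωᶜ ∩ Ici t) := ⟨t, fun x hx => hx.2⟩
    have hm := (hΩ.isClosed_compl.inter isClosed_Ici).csInf_mem h hbd
    refine ⟨_, lt_of_le_of_ne hm.2 fun he => hm.1 (by rw [← he]; exact ht), hm.1, fun x hx => ?_⟩
    by_contra hx'
    exact absurd (csInf_le hbd ⟨hx', hx.1⟩) (not_le.2 hx.2)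
  · left
    intro x hx
    by_contra hx'
    exact h ⟨x, hx', hx⟩

theorem connectedComponentIn_eq_of_forall_notMem {Ω I : Set ℝ} {t : ℝ} (ht : t ∈ I)
    (hI : I.OrdConnected) (hIΩ : I ⊆ Ω) (hb : ∀ y ∉ I, ∃ z ∈ uIcc y t, z ∉ Ω) :
    connectedComponentIn Ω t = I := by
  apply Subset.antisymm
  · intro y hy
    by_contra hyI
    obtain ⟨z, hz, hzΩ⟩ := hb y hyI
    have hoc := (isPreconnected_connectedComponentIn (F := Ω) (x := t)).ordConnected
    exact hzΩ (connectedComponentIn_subset Ω t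
      (hoc.uIcc_subset hy (mem_connectedComponentIn (hIΩ ht)) hz))
  · exact hI.isPreconnected.subset_connectedComponentIn ht hIΩ

theorem hardySobolevOn_connectedComponentIn {q : ℝ} {f : ℝ → ℂ} {Ω : Set ℝ} {φ : ℝ → ℝ}
    (hq : 4 ≤ q) (hΩ : IsOpen Ω) (hne : Ω ≠ univ) (hf : ContDiff ℝ 1 f)
    (hsupp : HasCompactSupport f) (hsub : tsupport f ⊆ Ω)
    (hφ : ∀ s, φ s = ‖deriv f s‖ ^ 2 - ‖f s‖ ^ 2 / (4 * infDist s Ωᶜ ^ 2))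
    (hφi : Integrable φ) {t : ℝ} (ht : t ∈ Ω) :
    HardySobolevOn q f φ (connectedComponentIn Ω t) := by
  rcases exists_left_endpoint hΩ ht with hl | ⟨a, hat, ha, hl⟩ <;>
  rcases exists_right_endpoint hΩ ht with hr | ⟨b, htb, hb, hr⟩
  · exact absurd (eq_univ_of_forall fun x => (le_total x t).elim (fun h => hl h) fun h => hr h) hne
  · have hI : Iio b ⊆ Ω := fun x hx => (le_total x t).elim (fun h => hl h) fun h => hr ⟨h, hx⟩
    rw [connectedComponentIn_eq_of_forall_notMem (I := Iio b) htb ordConnected_Iio hI fun y hy =>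
      ⟨b, by rw [uIcc_of_ge (htb.le.trans (not_lt.1 hy))]; exact ⟨htb.le, not_lt.1 hy⟩, hb⟩]
    exact hardySobolevOn_Iio hq hf hsupp hsub hφ hb hI
  · have hI : Ioi a ⊆ Ω := fun x hx => (le_total x t).elim (fun h => hl ⟨hx, h⟩) fun h => hr h
    rw [connectedComponentIn_eq_of_forall_notMem (I := Ioi a) hat ordConnected_Ioi hI fun y hy =>
      ⟨a, by rw [uIcc_of_le ((not_lt.1 hy).trans hat.le)]; exact ⟨not_lt.1 hy, hat.le⟩, ha⟩]
    exact hardySobolevOn_Ioi hq hf hsupp hsub hφ ha hI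
  · have hI : Ioo a b ⊆ Ω := fun x hx =>
      (le_total x t).elim (fun h => hl ⟨hx.1, h⟩) fun h => hr ⟨h, hx.2⟩
    rw [connectedComponentIn_eq_of_forall_notMem (I := Ioo a b) ⟨hat, htb⟩ ordConnected_Ioo hI
      fun y hy => by
        rcases le_or_gt y a with h | h
        · exact ⟨a, by rw [uIcc_of_le (h.trans hat.le)]; exact ⟨h, hat.le⟩, ha⟩
        · have h' : b ≤ y := not_lt.1 fun h' => hy ⟨h, h'⟩
          exact ⟨b, by rw [uIcc_of_ge (htb.le.trans h')]; exact ⟨htb.le, h'⟩, hb⟩]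
    exact hardySobolevOn_Ioo hq hf hsub hφ hφi (hat.trans htb) ha hb hI

/-- If an integrable function has nonnegative integral over every connected component of an open
set, then its integral over any one component is at most its integral over the whole set. -/
theorem setIntegral_connectedComponentIn_le {Ω : Set ℝ} (hΩ : IsOpen Ω) {φ : ℝ → ℝ}
    (hφi : Integrable φ) (h0 : ∀ t ∈ Ω, 0 ≤ ∫ s in connectedComponentIn Ω t, φ s) {t : ℝ}
    (ht : t ∈ Ω) : ∫ s in connectedComponentIn Ω t, φ s ≤ ∫ s in Ω, φ s := by
  set S : Set (Set ℝ) := connectedComponentIn Ω '' Ω with hS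
  have hdisj : S.PairwiseDisjoint id := by
    rintro _ ⟨x, hx, rfl⟩ _ ⟨y, hy, rfl⟩ hxy
    rw [Function.onFun, id, id, Set.disjoint_left]
    intro z hzx hzy
    exact hxy ((connectedComponentIn_eq hzx).trans (connectedComponentIn_eq hzy).symm)
  have hopen : ∀ C ∈ S, IsOpen C := by
    rintro _ ⟨x, hx, rfl⟩
    exact hΩ.connectedComponentIn
  have hcount : S.Countable := hdisj.countable_of_isOpen hopen (by
    rintro _ ⟨x, hx, rfl⟩
    exact ⟨x, mem_connectedComponentIn hx⟩)
  have hU : ⋃ C : S, (C : Set ℝ) = Ω := by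
    ext x
    simp only [mem_iUnion, Subtype.exists, exists_prop]
    constructor
    · rintro ⟨_, ⟨y, hy, rfl⟩, hx⟩
      exact connectedComponentIn_subset _ _ hx
    · exact fun hx => ⟨_, ⟨x, hx, rfl⟩, mem_connectedComponentIn hx⟩
  have := hcount.to_subtype
  have hsum := hasSum_integral_iUnion (μ := volume) (f := φ) (s := fun C : S => (C : Set ℝ))
    (fun C => (hopen C C.2).measurableSet)
    (fun C D hCD => hdisj C.2 D.2 fun h => hCD (Subtype.ext h)) hφi.integrableOn
  rw [hU] at hsum
  refine le_hasSum hsum ⟨_, t, ht, rfl⟩ ?_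
  rintro ⟨_, y, hy, rfl⟩ _
  exact h0 y hy

/-- Hölder interpolation of the `L^(q-2)` norm between `L²` and `L^q`. -/
theorem integral_rpow_le_interpolate {q : ℝ} (hq : 4 ≤ q) {f : ℝ → ℂ} (hf : Continuous f)
    (hsupp : HasCompactSupport f) (Ω : Set ℝ) :
    ∫ s in Ω, ‖f s‖ ^ (q - 2) ≤
      (∫ s in Ω, ‖f s‖ ^ 2) ^ (2 / (q - 2)) * (∫ s in Ω, ‖f s‖ ^ q) ^ ((q - 4) / (q - 2)) := by
  rcases hq.eq_or_lt with rfl | hq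
  · norm_num
  have h2 : 0 < q - 2 := by linarith
  have h4 : 0 < q - 4 := by linarith
  have hconj : ((q - 2) / 2).HolderConjugate ((q - 2) / (q - 4)) := by
    rw [Real.holderConjugate_iff]
    constructor
    · linarith
    · field_simp; ring
  have hmem : ∀ r : ℝ, 0 < r → ∀ p, MemLp (fun s => ‖f s‖ ^ r) p (volume.restrict Ω) := by
    intro r hr p
    have hc : Continuous fun s => ‖f s‖ ^ r := hf.norm.rpow_const fun _ => Or.inr hr.le
    refine (hc.memLp_of_hasCompactSupport ?_).restrict Ω
    exact hsupp.comp_left (g := fun z : ℂ => ‖z‖ ^ r) (by simp [hr.ne'])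
  have key := integral_mul_le_Lp_mul_Lq_of_nonneg (μ := volume.restrict Ω) hconj
    (f := fun s => ‖f s‖ ^ (4 / (q - 2))) (g := fun s => ‖f s‖ ^ (q * (q - 4) / (q - 2)))
    (Filter.Eventually.of_forall fun s => by positivity)
    (Filter.Eventually.of_forall fun s => by positivity)
    (hmem _ (by positivity) _) (hmem _ (by positivity) _)
  have e1 : ∀ s, ‖f s‖ ^ (4 / (q - 2)) * ‖f s‖ ^ (q * (q - 4) / (q - 2)) = ‖f s‖ ^ (q - 2) := by
    intro s
    rw [← Real.rpow_add_of_nonneg (norm_nonneg _) (by positivity) (by positivity)]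
    congr 1
    field_simp; ring
  have e2 : ∀ s, (‖f s‖ ^ (4 / (q - 2))) ^ ((q - 2) / 2) = ‖f s‖ ^ 2 := by
    intro s
    rw [← Real.rpow_mul (norm_nonneg _), ← Real.rpow_two]
    congr 1
    field_simp; norm_num
  have e3 : ∀ s, (‖f s‖ ^ (q * (q - 4) / (q - 2))) ^ ((q - 2) / (q - 4)) = ‖f s‖ ^ q := by
    intro s
    rw [← Real.rpow_mul (norm_nonneg _)]
    congr 1
    field_simp
  simpa only [e1, e2, e3, one_div_div] using key

theorem integrable_hardy_density {f : ℝ → ℂ} {Ω : Set ℝ} (hΩ : IsOpen Ω) (hne : Ω ≠ univ)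
    (hf : ContDiff ℝ 1 f) (hsupp : HasCompactSupport f) (hsub : tsupport f ⊆ Ω) :
    Integrable fun s => ‖deriv f s‖ ^ 2 - ‖f s‖ ^ 2 / (4 * infDist s Ωᶜ ^ 2) := by
  have hcne : Ωᶜ.Nonempty := nonempty_compl.2 hne
  refine Integrable.sub ?_ ?_
  · have hc : Continuous fun s => ‖deriv f s‖ ^ 2 := (hf.continuous_deriv le_rfl).norm.pow 2
    refine hc.integrable_of_hasCompactSupport ?_
    exact hsupp.deriv.comp_left (g := fun z : ℂ => ‖z‖ ^ 2) (by simp)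
  · refine Continuous.integrable_of_hasCompactSupport ?_ ?_
    · rw [continuous_iff_continuousAt]
      intro s
      by_cases hs : s ∈ tsupport f
      · have hpos : 0 < infDist s Ωᶜ :=
          (hΩ.isClosed_compl.notMem_iff_infDist_pos hcne).1 fun h => h (hsub hs)
        exact (hf.continuous.norm.pow 2).continuousAt.div
          (((continuous_infDist_pt _).pow 2).const_mul 4).continuousAt (by positivity)
      · have h : (fun s => ‖f s‖ ^ 2 / (4 * infDist s Ωᶜ ^ 2)) =ᶠ[nhds s] fun _ => 0 := by
          filter_upwards [notMem_tsupport_iff_eventuallyEq.1 hs] with x hx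
          simp [hx]
        exact continuousAt_const.congr h.symm
    · refine hsupp.mono' fun s hs => subset_tsupport f ?_
      intro h
      exact hs (by simp [h])

/-- Corollary 2: for `q ≥ 4`, every open set `Ω ⊊ ℝ` and every `f ∈ C_0^∞(Ω)`,
`sup_{t∈Ω} |f(t)|^q ≤ q² (∫_Ω (|f'|² − |f|²/(4 dist(t,Ωᶜ)²)) dt) (∫_Ω |f|² dt)^{2/(q−2)}
(∫_Ω |f|^q dt)^{(q−4)/(q−2)}`. -/
theorem one_dim_hardy_sobolev_interp (q : ℝ) (hq : 4 ≤ q) (Ω : Set ℝ) (hΩ : IsOpen Ω)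
    (hne : Ω ≠ Set.univ) (f : ℝ → ℂ) (hf : ContDiff ℝ (⊤ : ℕ∞) f)
    (hsupp : HasCompactSupport f) (hsub : tsupport f ⊆ Ω) :
    ∀ t ∈ Ω, ‖f t‖ ^ q ≤ q ^ 2 *
      (∫ s in Ω, (‖deriv f s‖ ^ 2 - ‖f s‖ ^ 2 / (4 * Metric.infDist s Ωᶜ ^ 2))) *
      (∫ s in Ω, ‖f s‖ ^ 2) ^ (2 / (q - 2)) *
      (∫ s in Ω, ‖f s‖ ^ q) ^ ((q - 4) / (q - 2)) := by
  intro t ht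
  have hf1 : ContDiff ℝ 1 f := hf.of_le (by exact_mod_cast le_top)
  have hφi := integrable_hardy_density hΩ hne hf1 hsupp hsub
  have hcomp : ∀ x ∈ Ω, HardySobolevOn q f _ (connectedComponentIn Ω x) := fun x hx =>
    hardySobolevOn_connectedComponentIn hq hΩ hne hf1 hsupp hsub (fun _ => rfl) hφi hx
  have hE := setIntegral_connectedComponentIn_le hΩ hφi (fun x hx => (hcomp x hx).1) ht
  have hB0 : 0 ≤ ∫ s in connectedComponentIn Ω t, ‖f s‖ ^ (q - 2) :=
    integral_nonneg fun s => by positivity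
  have hgi : Integrable fun s => ‖f s‖ ^ (q - 2) := by
    refine (hf.continuous.norm.rpow_const fun _ => Or.inr
      (by linarith)).integrable_of_hasCompactSupport ?_
    exact hsupp.comp_left (g := fun z : ℂ => ‖z‖ ^ (q - 2))
      (by rw [norm_zero, Real.zero_rpow (by linarith)])
  have hB : ∫ s in connectedComponentIn Ω t, ‖f s‖ ^ (q - 2) ≤ ∫ s in Ω, ‖f s‖ ^ (q - 2) :=
    setIntegral_mono_set hgi.integrableOn (Filter.Eventually.of_forall fun s => by positivity)
      (connectedComponentIn_subset Ω t).eventuallyLE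
  have hB' := hB.trans (integral_rpow_le_interpolate hq hf.continuous hsupp Ω)
  obtain ⟨hE0, hx⟩ := hcomp t ht
  have hx := pow_le_pow_left₀ (by positivity) (hx t (mem_connectedComponentIn ht)) 2
  rw [← Real.rpow_mul_natCast (norm_nonneg _), mul_pow, mul_pow, Real.sq_sqrt hE0,
    Real.sq_sqrt hB0, Nat.cast_ofNat, div_mul_cancel₀ q two_ne_zero] at hx
  refine hx.trans ?_
  rw [mul_assoc (q ^ 2 * _), mul_assoc (q ^ 2)]
  exact mul_le_mul_of_nonneg_left (mul_le_mul hE hB' hB0 (hE0.trans hE)) (by positivity)
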